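/- Let Ω ⊆ ℍ be a symmetric slice domain and let f₁, f₂ : Ω → ℍ be slice regular functions with no common zeros, i.e. for every q ∈ Ω either f₁(q) ≠ 0 or f₂(q) ≠ 0. Then there exist slice regular functions h₁, h₂ : Ω → ℍ such that for every q ∈ Ω one has T₁(q) + T₂(q) = 1, where T_ℓ(q) = f_ℓ(q) · h_ℓ(f_ℓ(q)⁻¹ q f_ℓ(q)) if f_ℓ(q) ≠ 0 and T_ℓ(q) = 0 if f_ℓ(q) = 0. (T_ℓ is the pointwise value of the regular product f_ℓ * h_ℓ; note that when f_ℓ(q) ≠ 0 the point f_ℓ(q)⁻¹ q f_ℓ(q) lies on the same sphere x + y𝕊 as q, hence in Ω.) -/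

import Mathlib

noncomputable section

/-- The 2-sphere of quaternionic imaginary units. -/
def QSphere : Set (Quaternion ℝ) := {q | q ^ 2 = -1}

/-- The complex plane `L_I = ℝ + ℝI` through an imaginary unit `I`. -/
def sliceL (I : Quaternion ℝ) : Set (Quaternion ℝ) :=
  {q | ∃ x y : ℝ, q = (x : Quaternion ℝ) + (y : Quaternion ℝ) * I}

/-- The planar parametrization of the restriction of `f` to the slice `L_I`. -/
def sliceMap (f : Quaternion ℝ → Quaternion ℝ) (I : Quaternion ℝ) : ℝ × ℝ → Quaternion ℝ :=
  fun p => f ((p.1 : Quaternion ℝ) + (p.2 : Quaternion ℝ) * I)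

/-- `f` is holomorphic (has continuous partial derivatives and satisfies
`(∂/∂x + I ∂/∂y) f = 0`) at the points of `U` lying in the slice `L_I`. -/
def HoloSlice (f : Quaternion ℝ → Quaternion ℝ) (I : Quaternion ℝ)
    (U : Set (Quaternion ℝ)) : Prop :=
  ∀ x y : ℝ, (x : Quaternion ℝ) + (y : Quaternion ℝ) * I ∈ U →
    ContDiffAt ℝ 1 (sliceMap f I) (x, y) ∧
    fderiv ℝ (sliceMap f I) (x, y) (1, 0) + I * fderiv ℝ (sliceMap f I) (x, y) (0, 1) = 0

/-- `f` is slice regular on `Ω`. -/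
def SliceRegularOn (f : Quaternion ℝ → Quaternion ℝ) (Ω : Set (Quaternion ℝ)) : Prop :=
  ∀ I ∈ QSphere, HoloSlice f I Ω

/-- `Ω` is a symmetric slice domain. -/
def IsSymmSliceDomain (Ω : Set (Quaternion ℝ)) : Prop :=
  IsOpen Ω ∧ IsConnected Ω ∧ (∃ x : ℝ, (x : Quaternion ℝ) ∈ Ω) ∧
  (∀ I ∈ QSphere, IsConnected (Ω ∩ sliceL I)) ∧
  (∀ x y : ℝ, ∀ I ∈ QSphere, (x : Quaternion ℝ) + (y : Quaternion ℝ) * I ∈ Ω →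
    ∀ J ∈ QSphere, (x : Quaternion ℝ) + (y : Quaternion ℝ) * J ∈ Ω)


open Classical in
/-- The pointwise value of the regular product `f * h`:
`(f*h)(q) = f(q) · h(f(q)⁻¹ q f(q))` if `f(q) ≠ 0`, and `0` if `f(q) = 0`. -/
def starMulVal (f h : Quaternion ℝ → Quaternion ℝ) (q : Quaternion ℝ) : Quaternion ℝ :=
  if f q = 0 then 0 else f q * h ((f q)⁻¹ * q * f q)

section Auxiliary

open Filter Topology Polynomial
open scoped ComplexConjugate

/-- A function holomorphic on a disc is uniformly approximated on smaller discs by entire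
functions. -/
lemma exists_differentiable_approx_on_ball {q : ℂ → ℂ} {R t ε : ℝ}
    (hq : DifferentiableOn ℂ q (Metric.ball 0 R)) (ht : 0 ≤ t) (htR : t < R) (hε : 0 < ε) :
    ∃ p : ℂ → ℂ, Differentiable ℂ p ∧ ∀ s : ℂ, ‖s‖ ≤ t → ‖q s - p s‖ ≤ ε := by
  obtain ⟨R', htR', hR'⟩ := exists_between htR
  obtain ⟨t', htt', ht'⟩ := exists_between htR'
  lift R' to NNReal using ht.trans htR'.le
  lift t' to NNReal using ht.trans htt'.le
  have hps := (hq.mono (Metric.closedBall_subset_ball hR')).hasFPowerSeriesOnBall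
    (NNReal.coe_pos.1 (ht.trans_lt htR'))
  have hu := hps.tendstoUniformlyOn' (r' := t') (by exact_mod_cast ht')
  obtain ⟨n, hn⟩ := (Metric.tendstoUniformlyOn_iff.1 hu ε hε).exists
  refine ⟨fun s => (cauchyPowerSeries q 0 R').partialSum n (s - 0), ?_, fun s hs => ?_⟩
  · simp only [FormalMultilinearSeries.partialSum, FormalMultilinearSeries.apply_eq_pow_smul_coeff]
    fun_prop
  · rw [← dist_eq_norm]
    exact (hn s (by simpa using hs.trans_lt htt')).le

/-- The standard exhaustion of a planar open set. -/
def planarExhaustion (D : Set ℂ) (n : ℕ) : Set ℂ :=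
  {z | ‖z‖ ≤ n ∧ ∀ b ∉ D, 1 ≤ n * ‖z - b‖}

lemma planarExhaustion_mono (D : Set ℂ) : Monotone (planarExhaustion D) := by
  intro m n hmn z hz
  have hmn' : (m : ℝ) ≤ n := by exact_mod_cast hmn
  exact ⟨hz.1.trans hmn', fun b hb => (hz.2 b hb).trans (by gcongr)⟩

lemma planarExhaustion_subset (D : Set ℂ) (n : ℕ) : planarExhaustion D n ⊆ D := by
  intro z hz
  by_contra hzD
  have := hz.2 z hzD
  simp at this
  linarith

lemma isCompact_planarExhaustion (D : Set ℂ) (n : ℕ) : IsCompact (planarExhaustion D n) := by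
  refine Metric.isCompact_of_isClosed_isBounded ?_ ?_
  · have : planarExhaustion D n = {z | ‖z‖ ≤ n} ∩ ⋂ b ∈ Dᶜ, {z | 1 ≤ n * ‖z - b‖} := by
      ext z
      simp [planarExhaustion]
    rw [this]
    refine (isClosed_le (by fun_prop) (by fun_prop)).inter
      (isClosed_biInter fun b _ => isClosed_le (by fun_prop) (by fun_prop))
  · exact isBounded_iff_forall_norm_le.2 ⟨n, fun z hz => hz.1⟩

lemma exists_planarExhaustion_mem_nhds {D : Set ℂ} (hD : IsOpen D) {z : ℂ} (hz : z ∈ D) :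
    ∃ n, planarExhaustion D n ∈ 𝓝 z := by
  obtain ⟨δ, hδ, hball⟩ := Metric.isOpen_iff.1 hD z hz
  obtain ⟨n, hn⟩ := exists_nat_ge (max (‖z‖ + 1) (2 / δ))
  refine ⟨n, Filter.mem_of_superset (Metric.ball_mem_nhds z (show 0 < min 1 (δ / 2) by positivity))
    fun w hw => ?_⟩
  rw [Metric.mem_ball, dist_eq_norm, lt_min_iff] at hw
  refine ⟨?_, fun b hb => ?_⟩
  · have := norm_le_norm_add_norm_sub' w z
    linarith [le_max_left (‖z‖ + 1) (2 / δ), hw.1]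
  · have hzb : δ ≤ ‖z - b‖ := by
      by_contra! h
      exact hb (hball (by rwa [Metric.mem_ball, dist_comm, dist_eq_norm]))
    have hwb : δ / 2 ≤ ‖w - b‖ := by
      have := norm_sub_le_norm_sub_add_norm_sub z w b
      rw [norm_sub_rev z w] at this
      linarith [hw.2]
    calc (1 : ℝ) = 2 / δ * (δ / 2) := by field_simp
      _ ≤ n * ‖w - b‖ := by
        gcongr
        exact (le_max_right _ _).trans hn

/-- Pole pushing: a rational function with its only pole at `a`, outside the `n`-th set of the
exhaustion, is approximated there by functions holomorphic on the whole open set. -/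
lemma exists_differentiableOn_approx_of_notMem {D : Set ℂ} {a : ℂ} (ha : a ∈ D) (P : ℂ[X]) {n : ℕ}
    (han : a ∉ planarExhaustion D n) {ε : ℝ} (hε : 0 < ε) :
    ∃ r : ℂ → ℂ, DifferentiableOn ℂ r D ∧
      ∀ w ∈ planarExhaustion D n, ‖P.eval (w - a)⁻¹ - r w‖ ≤ ε := by
  rcases lt_or_ge (n : ℝ) ‖a‖ with hna | hna
  · have hq : DifferentiableOn ℂ (fun w => P.eval (w - a)⁻¹) (Metric.ball 0 ‖a‖) := by
      intro w hw
      have hwa : w - a ≠ 0 := by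
        rintro h
        rw [sub_eq_zero.1 h] at hw
        simp at hw
      refine DifferentiableAt.differentiableWithinAt ?_
      exact P.differentiable.differentiableAt.comp w
        ((differentiableAt_id.sub_const a).inv hwa)
    obtain ⟨p, hp, hpε⟩ := exists_differentiable_approx_on_ball hq n.cast_nonneg hna hε
    exact ⟨p, hp.differentiableOn, fun w hw => hpε w hw.1⟩
  · obtain ⟨b, hb, hab⟩ : ∃ b ∉ D, n * ‖a - b‖ < 1 := by
      by_contra! h
      exact han ⟨hna, h⟩
    have hne : 0 < ‖a - b‖ := by
      rw [norm_pos_iff, sub_ne_zero]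
      rintro rfl
      exact hb ha
    have hq : DifferentiableOn ℂ (fun s => P.eval (s / (1 - s * (a - b))))
        (Metric.ball 0 ‖a - b‖⁻¹) := by
      intro s hs
      have hs1 : 1 - s * (a - b) ≠ 0 := by
        intro h
        have h1 : ‖s‖ * ‖a - b‖ = 1 := by
          rw [← norm_mul, ← sub_eq_zero.1 h, norm_one]
        rw [Metric.mem_ball, dist_zero_right, ← one_div, lt_div_iff₀ hne] at hs
        linarith
      refine DifferentiableAt.differentiableWithinAt ?_
      exact P.differentiable.differentiableAt.comp s
        (differentiableAt_id.div (by fun_prop) hs1)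
    obtain ⟨p, hp, hpε⟩ := exists_differentiable_approx_on_ball hq n.cast_nonneg
      (by rwa [← one_div, lt_div_iff₀ hne]) hε
    refine ⟨fun w => p (w - b)⁻¹, fun w hw => ?_, fun w hw => ?_⟩
    · have hwb : w - b ≠ 0 := sub_ne_zero.2 fun h => hb (h ▸ hw)
      refine DifferentiableAt.differentiableWithinAt ?_
      exact hp.differentiableAt.comp w ((differentiableAt_id.sub_const b).inv hwb)
    · have hwb : w - b ≠ 0 := sub_ne_zero.2 fun h => hb (h ▸ planarExhaustion_subset D n hw)
      have hwb' : 0 < ‖w - b‖ := norm_pos_iff.2 hwb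
      have hle : ‖(w - b)⁻¹‖ ≤ n := by
        rw [norm_inv, inv_le_iff_one_le_mul₀ hwb']
        exact hw.2 b hb
      have hwa : w - a ≠ 0 := sub_ne_zero.2 fun h => han (h ▸ hw)
      have heq : (w - b)⁻¹ / (1 - (w - b)⁻¹ * (a - b)) = (w - a)⁻¹ := by
        have : 1 - (w - b)⁻¹ * (a - b) = (w - b)⁻¹ * (w - a) := by
          field_simp
          ring
        rw [this]
        field_simp
      have := hpε _ hle
      rwa [heq] at this

lemma exists_differentiableOn_approx {D : Set ℂ} (hD : IsOpen D) {a : ℂ} (ha : a ∈ D) (P : ℂ[X])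
    {ε : ℝ} (hε : 0 < ε) :
    ∃ r : ℂ → ℂ, DifferentiableOn ℂ r D ∧ ∀ n, a ∉ planarExhaustion D n →
      ∀ w ∈ planarExhaustion D n, ‖P.eval (w - a)⁻¹ - r w‖ ≤ ε := by
  classical
  have hex : ∃ n, a ∈ planarExhaustion D n :=
    (exists_planarExhaustion_mem_nhds hD ha).imp fun _ h => mem_of_mem_nhds h
  rcases Nat.eq_zero_or_pos (Nat.find hex) with h0 | hpos
  · refine ⟨0, differentiableOn_const 0, fun n hn => absurd ?_ hn⟩
    exact planarExhaustion_mono D (Nat.zero_le n) (h0 ▸ Nat.find_spec hex)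
  · obtain ⟨r, hr, hrε⟩ := exists_differentiableOn_approx_of_notMem ha P
      (Nat.find_min hex (Nat.sub_lt hpos one_pos)) hε
    refine ⟨r, hr, fun n hn w hw => hrε w (planarExhaustion_mono D ?_ hw)⟩
    have : n < Nat.find hex := by
      by_contra! h
      exact hn (planarExhaustion_mono D h (Nat.find_spec hex))
    omega

/-- **Mittag-Leffler theorem** for an arbitrary open subset of the plane. -/
theorem exists_prescribed_principal_parts {D : Set ℂ} (hD : IsOpen D) (P : ℂ → ℂ[X])
    (hP : ∀ z ∈ D, ∀ᶠ w in 𝓝[≠] z, P w = 0) :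
    ∃ m : ℂ → ℂ, ∀ z ∈ D, ∃ ψ : ℂ → ℂ, AnalyticAt ℂ ψ z ∧
      ∀ᶠ w in 𝓝[≠] z, m w = (P z).eval (w - z)⁻¹ + ψ w := by
  classical
  set K := planarExhaustion D
  set Z : Set ℂ := {a ∈ D | P a ≠ 0} with hZ
  have hfin : ∀ n, (K n ∩ Z).Finite := by
    intro n
    have h : {w | P w = 0} ∈ codiscreteWithin (K n) := by
      rw [mem_codiscreteWithin_iff_forall_mem_nhdsNE]
      exact fun x hx => (hP x (planarExhaustion_subset D n hx)).mono fun w hw => Or.inl hw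
    refine ((isCompact_planarExhaustion D n).finite_sdiff_of_mem_codiscreteWithin h).subset ?_
    exact fun w hw => ⟨hw.1, hw.2.2⟩
  have hcount : Z.Countable := by
    refine (Set.countable_iUnion fun n => (hfin n).countable).mono fun a ha => ?_
    obtain ⟨n, hn⟩ := exists_planarExhaustion_mem_nhds hD ha.1
    exact Set.mem_iUnion.2 ⟨n, mem_of_mem_nhds hn, ha⟩
  have := hcount.toEncodable
  obtain ⟨ε, hε, c, hsum, -⟩ := posSumOfEncodable (ε := 1) one_pos Z
  choose r hr hrε using fun a : Z => exists_differentiableOn_approx hD a.2.1 (P a) (hε a)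
  set T : Z → ℂ → ℂ := fun a w => (P a).eval (w - a)⁻¹ - r a w with hT
  have hTdiff : ∀ (a : Z) (w : ℂ), w ∈ D → w ≠ a → DifferentiableAt ℂ (T a) w := by
    intro a w hw hwa
    exact ((P a).differentiable.differentiableAt.comp w
      ((differentiableAt_id.sub_const (a : ℂ)).inv (sub_ne_zero.2 hwa))).sub
      ((hr a).differentiableAt (hD.mem_nhds hw))
  refine ⟨fun w => ∑' a, T a w, fun z hz => ?_⟩
  obtain ⟨n, hn⟩ := exists_planarExhaustion_mem_nhds hD hz
  have hSfin : {a : Z | (a : ℂ) ∈ K n}.Finite :=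
    ((hfin n).preimage Subtype.val_injective.injOn).subset fun a ha => ⟨ha, a.2⟩
  set S := hSfin.toFinset with hS
  set tail : Z → ℂ → ℂ := fun a w => if a ∈ S then 0 else T a w with htail
  have hKD : interior (K n) ⊆ D := interior_subset.trans (planarExhaustion_subset D n)
  have hbound : ∀ a : Z, ∀ w ∈ K n, ‖tail a w‖ ≤ ε a := by
    intro a w hw
    simp only [htail]
    split_ifs with haS
    · simpa using (hε a).le
    · exact hrε a n (by simpa [hS] using haS) w hw
  have htd : DifferentiableOn ℂ (fun w => ∑' a, tail a w) (interior (K n)) := by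
    refine Complex.differentiableOn_tsum_of_summable_norm hsum.summable (fun a => ?_) isOpen_interior
      fun a w hw => hbound a w (interior_subset hw)
    by_cases haS : a ∈ S
    · simp only [htail, haS, if_true]
      exact differentiableOn_const 0
    · simp only [htail, haS, if_false]
      intro w hw
      refine (hTdiff a w (hKD hw) ?_).differentiableWithinAt
      rintro rfl
      exact haS (by simpa [hS] using interior_subset hw)
  have hzi : z ∈ interior (K n) := mem_interior_iff_mem_nhds.2 hn
  have hint : interior (K n) ∈ 𝓝 z := isOpen_interior.mem_nhds hzi
  refine ⟨fun w => (∑ a ∈ S, if (a : ℂ) = z then -r a w else T a w) + ∑' a, tail a w, ?_, ?_⟩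
  · refine AnalyticAt.add (Finset.analyticAt_fun_sum _ fun a _ => ?_)
      (htd.analyticAt hint)
    split_ifs with h
    · exact ((hr a).analyticAt (hD.mem_nhds hz)).neg
    · have hopen : IsOpen (D \ {(a : ℂ)}) := hD.sdiff isClosed_singleton
      exact DifferentiableOn.analyticAt (s := D \ {(a : ℂ)})
        (fun w hw => (hTdiff a w hw.1 hw.2).differentiableWithinAt)
        (hopen.mem_nhds ⟨hz, fun h' => h h'.symm⟩)
  · filter_upwards [mem_nhdsWithin_of_mem_nhds hint] with w hw
    have hs1 : HasSum (fun a => tail a w) (∑' a, tail a w) :=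
      (Summable.of_norm_bounded hsum.summable
        fun a => hbound a w (interior_subset hw)).hasSum
    have hs2 : HasSum (fun a => if a ∈ S then T a w else 0) (∑ a ∈ S, T a w) := by
      have : HasSum (fun a => if a ∈ S then T a w else 0)
          (∑ a ∈ S, if a ∈ S then T a w else 0) :=
        hasSum_sum_of_ne_finset_zero fun a ha => by simp [ha]
      rwa [Finset.sum_congr rfl (fun a ha => if_pos ha)] at this
    have hs3 : (∑' a, T a w) = ∑ a ∈ S, T a w + ∑' a, tail a w := by
      rw [← (hs2.add hs1).tsum_eq]
      refine tsum_congr fun a => ?_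
      simp only [htail]
      split_ifs <;> simp
    have hs4 : ∑ a ∈ S, T a w = (P z).eval (w - z)⁻¹ +
        ∑ a ∈ S, if (a : ℂ) = z then -r a w else T a w := by
      have hsplit : ∀ a ∈ S, T a w = (if (a : ℂ) = z then (P z).eval (w - z)⁻¹ else 0) +
          if (a : ℂ) = z then -r a w else T a w := by
        intro a _
        split_ifs with h
        · simp [hT, h, sub_eq_add_neg]
        · simp
      rw [Finset.sum_congr rfl hsplit, Finset.sum_add_distrib]
      congr 1
      by_cases hPz : P z = 0
      · simp [hPz]
      · have hzS : (⟨z, hz, hPz⟩ : Z) ∈ S := by simpa [hS] using mem_of_mem_nhds hn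
        rw [Finset.sum_eq_single_of_mem _ hzS fun a _ ha =>
          if_neg fun h => ha (Subtype.ext h)]
        simp
    simp only [hs3, hs4, add_assoc]

/-- A quotient by a power of `w - a` is a polynomial in `(w - a)⁻¹` plus an analytic function. -/
lemma AnalyticAt.exists_principal_part_div_pow {φ : ℂ → ℂ} {a : ℂ} (hφ : AnalyticAt ℂ φ a)
    (n : ℕ) : ∃ (P : ℂ[X]) (ψ : ℂ → ℂ), AnalyticAt ℂ ψ a ∧
      ∀ w, w ≠ a → φ w / (w - a) ^ n = P.eval (w - a)⁻¹ + ψ w := by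
  induction n generalizing φ with
  | zero => exact ⟨0, φ, hφ, by simp⟩
  | succ n ih =>
    have hd : AnalyticAt ℂ (dslope φ a) a := by
      obtain ⟨p, hp⟩ := hφ
      exact ⟨_, hp.has_fpower_series_dslope_fslope⟩
    obtain ⟨P, ψ, hψ, h⟩ := ih hd
    refine ⟨C (φ a) * X ^ (n + 1) + P, ψ, hψ, fun w hw => ?_⟩
    have hwa : w - a ≠ 0 := sub_ne_zero.2 hw
    have hs : φ w = φ a + (w - a) * dslope φ a w := by
      rw [← smul_eq_mul, sub_smul_dslope]
      ring
    rw [eval_add, eval_mul, eval_C, eval_pow, eval_X, add_assoc, ← h w hw, hs, inv_pow]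
    field_simp
    ring

lemma AnalyticAt.exists_principal_part_inv {g : ℂ → ℂ} {a : ℂ} (hg : AnalyticAt ℂ g a)
    (hne : ¬ ∀ᶠ w in 𝓝 a, g w = 0) : ∃ (P : ℂ[X]) (ψ : ℂ → ℂ), AnalyticAt ℂ ψ a ∧
      ∀ᶠ w in 𝓝[≠] a, (g w)⁻¹ = P.eval (w - a)⁻¹ + ψ w := by
  obtain ⟨n, φ, hφ, hφa, hgφ⟩ := hg.exists_eventuallyEq_pow_smul_nonzero_iff.2 hne
  obtain ⟨P, ψ, hψ, h⟩ := (hφ.inv hφa).exists_principal_part_div_pow n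
  refine ⟨P, ψ, hψ, ?_⟩
  filter_upwards [hgφ.filter_mono nhdsWithin_le_nhds, self_mem_nhdsWithin] with w hw hwa
  rw [← h w hwa, hw, smul_eq_mul, mul_inv, Pi.inv_apply, div_eq_mul_inv, mul_comm]

/-- Removable singularities can be removed simultaneously. -/
lemma exists_analyticOnNhd_of_removable {D : Set ℂ} {V : ℂ → ℂ}
    (hV : ∀ z ∈ D, ∃ ψ : ℂ → ℂ, AnalyticAt ℂ ψ z ∧ V =ᶠ[𝓝[≠] z] ψ) :
    ∃ W : ℂ → ℂ, AnalyticOnNhd ℂ W D ∧ ∀ z ∈ D, W =ᶠ[𝓝[≠] z] V := by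
  have hV' : ∀ z, ∃ ψ : ℂ → ℂ, z ∈ D → AnalyticAt ℂ ψ z ∧ V =ᶠ[𝓝[≠] z] ψ := by
    intro z
    by_cases hz : z ∈ D
    · obtain ⟨ψ, h⟩ := hV z hz
      exact ⟨ψ, fun _ => h⟩
    · exact ⟨0, fun h => absurd h hz⟩
  choose ψ hψ using hV'
  classical
  let W : ℂ → ℂ := fun z => if z ∈ D then ψ z z else V z
  have key : ∀ z ∈ D, W =ᶠ[𝓝 z] ψ z := by
    intro z hz
    rw [← nhdsNE_sup_pure, EventuallyEq, eventually_sup]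
    refine ⟨?_, by simp [W, hz]⟩
    have h1 := (hψ z hz).2
    have h2 : ∀ᶠ w in 𝓝[≠] z, AnalyticAt ℂ (ψ z) w :=
      (hψ z hz).1.eventually_analyticAt.filter_mono nhdsWithin_le_nhds
    filter_upwards [eventually_eventually_nhdsWithin.2 h1, h1, h2, self_mem_nhdsWithin]
      with w hw hw' hwan hwz
    by_cases hwD : w ∈ D
    · have hw2 : ψ w =ᶠ[𝓝[≠] w] ψ z := by
        rw [isOpen_compl_singleton.nhdsWithin_eq hwz] at hw
        exact (hψ w hwD).2.symm.trans (hw.filter_mono nhdsWithin_le_nhds)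
      have := tendsto_nhds_unique_of_eventuallyEq
        ((hψ w hwD).1.continuousAt.tendsto.mono_left nhdsWithin_le_nhds)
        (hwan.continuousAt.tendsto.mono_left nhdsWithin_le_nhds) hw2
      simpa [W, hwD] using this
    · simpa [W, hwD] using hw'
  refine ⟨W, fun z hz => (hψ z hz).1.congr (key z hz).symm, fun z hz => ?_⟩
  exact ((key z hz).filter_mono nhdsWithin_le_nhds).trans (hψ z hz).2.symm

/-- Finitely many holomorphic functions without common zeros on a planar domain generate the unit
ideal. -/
theorem exists_bezout_of_no_common_zeros {ι : Type*} [Fintype ι] {D : Set ℂ} (hD : IsOpen D)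
    (hconn : IsConnected D) {g : ι → ℂ → ℂ} (hg : ∀ i, AnalyticOnNhd ℂ (g i) D)
    (hnz : ∀ z ∈ D, ∃ i, g i z ≠ 0) :
    ∃ u : ι → ℂ → ℂ, (∀ i, AnalyticOnNhd ℂ (u i) D) ∧ ∀ z ∈ D, ∑ i, u i z * g i z = 1 := by
  classical
  obtain ⟨z₀, hz₀⟩ := hconn.nonempty
  obtain ⟨o, ho⟩ := hnz z₀ hz₀
  have hnot : ∀ z ∈ D, ¬ ∀ᶠ w in 𝓝 z, g o w = 0 := fun z hz h =>
    ho ((hg o).eqOn_zero_of_preconnected_of_eventuallyEq_zero hconn.isPreconnected hz h hz₀)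
  have hne : ∀ z ∈ D, ∀ᶠ w in 𝓝[≠] z, g o w ≠ 0 := fun z hz =>
    ((hg o z hz).eventually_eq_zero_or_eventually_ne_zero).resolve_left (hnot z hz)
  have : Nonempty ι := ⟨o⟩
  have hnz' : ∀ z, ∃ i, z ∈ D → g i z ≠ 0 := fun z => by
    by_cases hz : z ∈ D
    · exact (hnz z hz).imp fun i h _ => h
    · exact ⟨o, fun h => absurd h hz⟩
  choose k hk using hnz'
  have hkne : ∀ z ∈ D, ∀ᶠ w in 𝓝 z, g (k z) w ≠ 0 := fun z hz =>
    (hg (k z) z hz).continuousAt.eventually_ne (hk z hz)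
  have hpp : ∀ z, ∃ P : ℂ[X], (g o z ≠ 0 → P = 0) ∧ (z ∈ D → ∃ ψ : ℂ → ℂ, AnalyticAt ℂ ψ z ∧
      ∀ᶠ w in 𝓝[≠] z, (g o w * g (k z) w)⁻¹ = P.eval (w - z)⁻¹ + ψ w) := by
    intro z
    by_cases hz : z ∈ D
    · have hprod : AnalyticAt ℂ (fun w => g o w * g (k z) w) z := (hg o z hz).mul (hg (k z) z hz)
      by_cases hoz : g o z = 0
      · obtain ⟨P, ψ, h⟩ := hprod.exists_principal_part_inv (fun h => hnot z hz (by
          filter_upwards [h, hkne z hz] with w hw hw'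
          exact (mul_eq_zero.1 hw).resolve_right hw'))
        exact ⟨P, fun h => absurd hoz h, fun _ => ⟨ψ, h⟩⟩
      · exact ⟨0, fun _ => rfl, fun _ => ⟨_, hprod.inv (mul_ne_zero hoz (hk z hz)), by simp⟩⟩
    · exact ⟨0, fun _ => rfl, fun h => absurd h hz⟩
  choose P hP0 hP using hpp
  choose m hm using fun i => exists_prescribed_principal_parts hD
    (fun z => if i = k z then P z else 0) (fun z hz => by
      filter_upwards [hne z hz] with w hw
      simp [hP0 w hw])
  have hloc : ∀ z ∈ D, ∀ i, ∃ ψ : ℂ → ℂ, AnalyticAt ℂ ψ z ∧ ∀ᶠ w in 𝓝[≠] z,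
      m i w = (if i = k z then (g o w * g (k z) w)⁻¹ else 0) + ψ w := by
    intro z hz i
    obtain ⟨ψ₁, hψ₁, h₁⟩ := hm i z hz
    obtain ⟨ψ₂, hψ₂, h₂⟩ := hP z hz
    by_cases hi : i = k z
    · refine ⟨fun w => ψ₁ w - ψ₂ w, hψ₁.sub hψ₂, ?_⟩
      filter_upwards [h₁, h₂] with w hw₁ hw₂
      rw [hw₁, if_pos hi, if_pos hi, hw₂]
      ring
    · refine ⟨ψ₁, hψ₁, ?_⟩
      filter_upwards [h₁] with w hw₁
      rw [hw₁, if_neg hi, if_neg hi, eval_zero]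
  let V : ι → ℂ → ℂ := fun i w =>
    g o w * m i w + if i = o then (g o w)⁻¹ - ∑ j, m j w * g j w else 0
  have hVrem : ∀ i, ∀ z ∈ D, ∃ ψ : ℂ → ℂ, AnalyticAt ℂ ψ z ∧ V i =ᶠ[𝓝[≠] z] ψ := by
    intro i z hz
    choose ψ hψ h using hloc z hz
    refine ⟨fun w => (if i = k z then (g (k z) w)⁻¹ else 0) + g o w * ψ i w -
      if i = o then ∑ j, ψ j w * g j w else 0, ?_, ?_⟩
    · refine AnalyticAt.sub (AnalyticAt.add ?_ ((hg o z hz).mul (hψ i))) ?_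
      · split_ifs
        · exact (hg (k z) z hz).inv (hk z hz)
        · exact analyticAt_const
      · split_ifs
        · exact Finset.analyticAt_fun_sum _ fun j _ => (hψ j).mul (hg j z hz)
        · exact analyticAt_const
    · filter_upwards [eventually_all.2 h, hne z hz,
        (hkne z hz).filter_mono nhdsWithin_le_nhds] with w hw how hkw
      have hsum : ∑ j, m j w * g j w = (g o w)⁻¹ + ∑ j, ψ j w * g j w := by
        simp only [hw, add_mul, Finset.sum_add_distrib, ite_mul, zero_mul, Finset.sum_ite_eq',
          Finset.mem_univ, if_true]
        congr 1
        field_simp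
      simp only [V, hsum, hw i]
      split_ifs <;> field_simp <;> ring
  choose W hW hWV using fun i => exists_analyticOnNhd_of_removable (hVrem i)
  refine ⟨W, hW, fun z hz => ?_⟩
  have hcont : ContinuousAt (fun w => ∑ i, W i w * g i w) z :=
    tendsto_finsetSum _ fun i _ => ((hW i z hz).continuousAt.mul (hg i z hz).continuousAt)
  refine tendsto_nhds_unique_of_eventuallyEq (hcont.tendsto.mono_left nhdsWithin_le_nhds)
    (tendsto_const_nhds (x := (1 : ℂ))) (l := 𝓝[≠] z) ?_
  filter_upwards [eventually_all.2 fun i => hWV i z hz, hne z hz] with w hw how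
  have h1 : ∑ i, V i w * g i w = g o w * ∑ i, m i w * g i w +
      ((g o w)⁻¹ - ∑ j, m j w * g j w) * g o w := by
    simp only [V, add_mul, Finset.sum_add_distrib, ite_mul, zero_mul, Finset.sum_ite_eq',
      Finset.mem_univ, if_true, Finset.mul_sum, mul_assoc]
  simp only [hw, h1]
  field_simp
  ring

/-- The symmetrization of a function under complex conjugation. -/
def conjSymm (g : ℂ → ℂ) (z : ℂ) : ℂ := (g z + conj (g (conj z))) / 2

/-- The ring of functions that are holomorphic on `D` and commute there with conjugation. -/
def stemRing (D : Set ℂ) : Subring (ℂ → ℂ) where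
  carrier := {g | DifferentiableOn ℂ g D ∧ ∀ z ∈ D, g (conj z) = conj (g z)}
  mul_mem' ha hb := ⟨ha.1.mul hb.1, fun z hz => by simp [ha.2 z hz, hb.2 z hz]⟩
  one_mem' := ⟨differentiableOn_const 1, fun z _ => by simp⟩
  add_mem' ha hb := ⟨ha.1.add hb.1, fun z hz => by simp [ha.2 z hz, hb.2 z hz]⟩
  zero_mem' := ⟨differentiableOn_const 0, fun z _ => by simp⟩
  neg_mem' ha := ⟨ha.1.neg, fun z hz => by simp [ha.2 z hz]⟩

lemma conjSymm_mem_stemRing {D : Set ℂ} (hD : IsOpen D) (hsymm : ∀ z ∈ D, conj z ∈ D)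
    {g : ℂ → ℂ} (hg : DifferentiableOn ℂ g D) : conjSymm g ∈ stemRing D := by
  refine ⟨fun z hz => DifferentiableAt.differentiableWithinAt ?_, fun z _ => ?_⟩
  · have h1 : DifferentiableAt ℂ g z := hg.differentiableAt (hD.mem_nhds hz)
    have h2 : DifferentiableAt ℂ (conj ∘ g ∘ conj) z :=
      differentiableAt_conj_conj_iff.2 (hg.differentiableAt (hD.mem_nhds (hsymm z hz)))
    exact (h1.add h2).div_const 2
  · simp [conjSymm, add_comm, Complex.conj_ofNat]

lemma exists_stemRing_bezout {ι : Type*} [Fintype ι] {D : Set ℂ} (hD : IsOpen D)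
    (hconn : IsConnected D) (hsymm : ∀ z ∈ D, conj z ∈ D) (g : ι → stemRing D)
    (hnz : ∀ z ∈ D, ∃ i, (g i : ℂ → ℂ) z ≠ 0) :
    ∃ u : ι → stemRing D, ∀ z ∈ D, ∑ i, (u i : ℂ → ℂ) z * (g i : ℂ → ℂ) z = 1 := by
  obtain ⟨u, hu, hsum⟩ := exists_bezout_of_no_common_zeros hD hconn
    (fun i => (g i).2.1.analyticOnNhd hD) hnz
  refine ⟨fun i => ⟨_, conjSymm_mem_stemRing hD hsymm (hu i).differentiableOn⟩, fun z hz => ?_⟩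
  have h1 := hsum z hz
  have h2 := congrArg conj (hsum _ (hsymm z hz))
  simp only [map_sum, map_mul, map_one, (g _).2.2 z hz, Complex.conj_conj] at h2
  have : ∀ i, conjSymm (u i) z * (g i : ℂ → ℂ) z =
      (u i z * (g i : ℂ → ℂ) z + conj (u i (conj z)) * (g i : ℂ → ℂ) z) / 2 := by
    intro i
    rw [conjSymm]
    ring
  simp only [this, ← Finset.sum_div, Finset.sum_add_distrib, h1, h2]
  norm_num

section Sphere

variable {I : Quaternion ℝ}

lemma QSphere.mul_self (hI : I ∈ QSphere) : I * I = -1 := by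
  rw [← sq]
  exact hI

lemma QSphere.re_eq_zero (hI : I ∈ QSphere) : I.re = 0 := by
  have h := QSphere.mul_self hI
  rw [Quaternion.ext_iff] at h
  simp only [Quaternion.re_mul, Quaternion.imI_mul, Quaternion.imJ_mul, Quaternion.imK_mul,
    Quaternion.re_neg, Quaternion.imI_neg, Quaternion.imJ_neg, Quaternion.imK_neg,
    Quaternion.re_one, Quaternion.imI_one, Quaternion.imJ_one, Quaternion.imK_one] at h
  obtain ⟨h0, h1, h2, h3⟩ := h
  by_contra hre
  have e1 : I.imI = 0 := mul_left_cancel₀ hre (by linarith)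
  have e2 : I.imJ = 0 := mul_left_cancel₀ hre (by linarith)
  have e3 : I.imK = 0 := mul_left_cancel₀ hre (by linarith)
  rw [e1, e2, e3] at h0
  nlinarith [mul_self_nonneg I.re]

lemma QSphere.norm_eq_one (hI : I ∈ QSphere) : ‖I‖ = 1 := by
  have h := congrArg norm (QSphere.mul_self hI)
  rw [norm_mul, norm_neg, norm_one] at h
  nlinarith [norm_nonneg I]

lemma QSphere.neg_mem (hI : I ∈ QSphere) : -I ∈ QSphere := by
  change (-I) ^ 2 = -1
  rw [neg_sq]
  exact hI

lemma QSphere.star_eq_neg (hI : I ∈ QSphere) : star I = -I := by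
  have := QSphere.re_eq_zero hI
  ext <;> simp [this]

lemma QSphere.inv_mul_mul_mem (hI : I ∈ QSphere) {c : Quaternion ℝ} (hc : c ≠ 0) :
    c⁻¹ * I * c ∈ QSphere := by
  change (c⁻¹ * I * c) ^ 2 = -1
  calc (c⁻¹ * I * c) ^ 2 = c⁻¹ * I * (c * c⁻¹) * I * c := by simp only [sq, mul_assoc]
    _ = c⁻¹ * (I * I) * c := by rw [mul_inv_cancel₀ hc]; simp only [mul_assoc, one_mul]
    _ = -1 := by rw [QSphere.mul_self hI]; simp [hc]

/-- The imaginary unit `i`. -/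
def unitI : Quaternion ℝ := ⟨0, 1, 0, 0⟩

@[simp] lemma re_unitI : unitI.re = 0 := rfl

@[simp] lemma imI_unitI : unitI.imI = 1 := rfl

@[simp] lemma imJ_unitI : unitI.imJ = 0 := rfl

@[simp] lemma imK_unitI : unitI.imK = 0 := rfl

lemma unitI_mem_QSphere : unitI ∈ QSphere := by
  change unitI ^ 2 = -1
  rw [sq]
  ext <;> simp [Quaternion.re_one, Quaternion.imI_one, Quaternion.imJ_one, Quaternion.imK_one]

/-- Orthogonal quaternions of equal norm differ by left multiplication by an imaginary unit. -/
lemma exists_mem_QSphere_add_mul_eq_zero {a b : Quaternion ℝ}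
    (hn : Quaternion.normSq a = Quaternion.normSq b) (ho : (a * star b).re = 0) :
    ∃ J ∈ QSphere, a + J * b = 0 := by
  by_cases hb : b = 0
  · subst hb
    rw [map_zero, Quaternion.normSq_eq_zero] at hn
    exact ⟨unitI, unitI_mem_QSphere, by simp [hn]⟩
  · have hb' : Quaternion.normSq b ≠ 0 := Quaternion.normSq_ne_zero.2 hb
    have hre : (a * b⁻¹).re = 0 := by
      rw [Quaternion.inv_def, mul_smul_comm, Quaternion.re_smul, ho, smul_zero]
    have hstar : star (a * b⁻¹) = -(a * b⁻¹) := by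
      ext <;> simp only [Quaternion.re_star, Quaternion.imI_star, Quaternion.imJ_star,
        Quaternion.imK_star, Quaternion.re_neg, Quaternion.imI_neg, Quaternion.imJ_neg,
        Quaternion.imK_neg, hre, neg_zero]
    have hsq : a * b⁻¹ * star (a * b⁻¹) = 1 := by
      rw [Quaternion.self_mul_star, map_mul, Quaternion.normSq_inv, hn, mul_inv_cancel₀ hb',
        Quaternion.coe_one]
    refine ⟨-(a * b⁻¹), ?_, ?_⟩
    · change (-(a * b⁻¹)) ^ 2 = -1
      rw [neg_sq, sq, ← hsq, hstar, mul_neg, neg_neg]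
    · rw [neg_mul, mul_assoc, inv_mul_cancel₀ hb, mul_one, add_neg_cancel]

lemma exists_mem_QSphere_common_zero {a₁ b₁ a₂ b₂ : Quaternion ℝ}
    (hn₁ : Quaternion.normSq a₁ = Quaternion.normSq b₁) (ho₁ : (a₁ * star b₁).re = 0)
    (hn₂ : Quaternion.normSq a₂ = Quaternion.normSq b₂) (ho₂ : (a₂ * star b₂).re = 0)
    (h : star a₂ * b₁ + star b₂ * a₁ = 0) :
    ∃ J ∈ QSphere, a₁ + J * b₁ = 0 ∧ a₂ + J * b₂ = 0 := by
  by_cases hb : b₁ = 0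
  · subst hb
    rw [map_zero, Quaternion.normSq_eq_zero] at hn₁
    obtain ⟨J, hJ, h2⟩ := exists_mem_QSphere_add_mul_eq_zero hn₂ ho₂
    exact ⟨J, hJ, by simp [hn₁], h2⟩
  · obtain ⟨J, hJ, h1⟩ := exists_mem_QSphere_add_mul_eq_zero hn₁ ho₁
    refine ⟨J, hJ, h1, ?_⟩
    rw [eq_neg_of_add_eq_zero_left h1] at h
    have h2 : (star a₂ - star b₂ * J) * b₁ = 0 := by
      rw [← h]
      noncomm_ring
    have h3 := congrArg star ((mul_eq_zero.1 h2).resolve_right hb)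
    rw [star_sub, star_mul, star_star, star_star, QSphere.star_eq_neg hJ, star_zero] at h3
    rw [← h3]
    noncomm_ring

end Sphere

section Stem

variable {D : Set ℂ}

/-- The real part of a quaternionic stem function. -/
def stemRe (F : Quaternion (stemRing D)) (z : ℂ) : Quaternion ℝ :=
  ⟨((F.re : ℂ → ℂ) z).re, ((F.imI : ℂ → ℂ) z).re, ((F.imJ : ℂ → ℂ) z).re,
    ((F.imK : ℂ → ℂ) z).re⟩

/-- The imaginary part of a quaternionic stem function. -/
def stemIm (F : Quaternion (stemRing D)) (z : ℂ) : Quaternion ℝ :=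
  ⟨((F.re : ℂ → ℂ) z).im, ((F.imI : ℂ → ℂ) z).im, ((F.imJ : ℂ → ℂ) z).im,
    ((F.imK : ℂ → ℂ) z).im⟩

@[simp] lemma re_stemRe (F : Quaternion (stemRing D)) (z : ℂ) :
    (stemRe F z).re = ((F.re : ℂ → ℂ) z).re := rfl

@[simp] lemma imI_stemRe (F : Quaternion (stemRing D)) (z : ℂ) :
    (stemRe F z).imI = ((F.imI : ℂ → ℂ) z).re := rfl

@[simp] lemma imJ_stemRe (F : Quaternion (stemRing D)) (z : ℂ) :
    (stemRe F z).imJ = ((F.imJ : ℂ → ℂ) z).re := rfl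

@[simp] lemma imK_stemRe (F : Quaternion (stemRing D)) (z : ℂ) :
    (stemRe F z).imK = ((F.imK : ℂ → ℂ) z).re := rfl

@[simp] lemma re_stemIm (F : Quaternion (stemRing D)) (z : ℂ) :
    (stemIm F z).re = ((F.re : ℂ → ℂ) z).im := rfl

@[simp] lemma imI_stemIm (F : Quaternion (stemRing D)) (z : ℂ) :
    (stemIm F z).imI = ((F.imI : ℂ → ℂ) z).im := rfl

@[simp] lemma imJ_stemIm (F : Quaternion (stemRing D)) (z : ℂ) :
    (stemIm F z).imJ = ((F.imJ : ℂ → ℂ) z).im := rfl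

@[simp] lemma imK_stemIm (F : Quaternion (stemRing D)) (z : ℂ) :
    (stemIm F z).imK = ((F.imK : ℂ → ℂ) z).im := rfl

/-- The value at `x + yI` of the slice function induced by `F`, where `z = x + iy`. -/
def stemVal (F : Quaternion (stemRing D)) (I : Quaternion ℝ) (z : ℂ) : Quaternion ℝ :=
  stemRe F z + I * stemIm F z

lemma stemRe_mul (F G : Quaternion (stemRing D)) (z : ℂ) :
    stemRe (F * G) z = stemRe F z * stemRe G z - stemIm F z * stemIm G z := by
  ext <;> simp <;> ring

lemma stemIm_mul (F G : Quaternion (stemRing D)) (z : ℂ) :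
    stemIm (F * G) z = stemRe F z * stemIm G z + stemIm F z * stemRe G z := by
  ext <;> simp <;> ring

lemma stemVal_add (F G : Quaternion (stemRing D)) (I : Quaternion ℝ) (z : ℂ) :
    stemVal (F + G) I z = stemVal F I z + stemVal G I z := by
  ext <;> simp [stemVal] <;> ring

lemma stemRe_star (F : Quaternion (stemRing D)) (z : ℂ) : stemRe (star F) z = star (stemRe F z) := by
  ext <;> simp

lemma stemIm_star (F : Quaternion (stemRing D)) (z : ℂ) : stemIm (star F) z = star (stemIm F z) := by
  ext <;> simp

lemma stemVal_mul {I : Quaternion ℝ} (hI : I ∈ QSphere) (F G : Quaternion (stemRing D)) (z : ℂ) :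
    stemVal (F * G) I z = stemVal F I z * stemRe G z + I * stemVal F I z * stemIm G z := by
  have h (x : Quaternion ℝ) : I * (I * x) = -x := by
    rw [← mul_assoc, QSphere.mul_self hI, neg_one_mul]
  rw [stemVal, stemRe_mul, stemIm_mul]
  simp only [stemVal, mul_add, add_mul, mul_assoc, h, neg_mul]
  abel

lemma stemRe_conj (F : Quaternion (stemRing D)) {z : ℂ} (hz : z ∈ D) :
    stemRe F (conj z) = stemRe F z := by
  ext <;> simp [F.re.2.2 z hz, F.imI.2.2 z hz, F.imJ.2.2 z hz, F.imK.2.2 z hz]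

lemma stemIm_conj (F : Quaternion (stemRing D)) {z : ℂ} (hz : z ∈ D) :
    stemIm F (conj z) = -stemIm F z := by
  ext <;> simp [F.re.2.2 z hz, F.imI.2.2 z hz, F.imJ.2.2 z hz, F.imK.2.2 z hz]

lemma stemVal_conj (F : Quaternion (stemRing D)) (I : Quaternion ℝ) {z : ℂ} (hz : z ∈ D) :
    stemVal F (-I) (conj z) = stemVal F I z := by
  rw [stemVal, stemRe_conj F hz, stemIm_conj F hz, neg_mul_neg, stemVal]

lemma exists_mem_QSphere_stemVal_eq_zero {F₁ F₂ : Quaternion (stemRing D)} {z : ℂ}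
    (h₁ : ((F₁ * star F₁).re : ℂ → ℂ) z = 0) (h₂ : ((F₂ * star F₂).re : ℂ → ℂ) z = 0)
    (h : stemIm (star F₂ * F₁) z = 0) :
    ∃ J ∈ QSphere, stemVal F₁ J z = 0 ∧ stemVal F₂ J z = 0 := by
  have key : ∀ F : Quaternion (stemRing D), ((F * star F).re : ℂ → ℂ) z = 0 →
      Quaternion.normSq (stemRe F z) = Quaternion.normSq (stemIm F z) ∧
        (stemRe F z * star (stemIm F z)).re = 0 := by
    intro F hF
    rw [Complex.ext_iff] at hF
    simp at hF
    constructor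
    · simp only [Quaternion.normSq_def', re_stemRe, imI_stemRe, imJ_stemRe, imK_stemRe,
        re_stemIm, imI_stemIm, imJ_stemIm, imK_stemIm]
      linarith [hF.1]
    · simp
      linarith [hF.2]
  rw [stemIm_mul, stemRe_star, stemIm_star] at h
  exact exists_mem_QSphere_common_zero (key F₁ h₁).1 (key F₁ h₁).2 (key F₂ h₂).1 (key F₂ h₂).2 h

/-- The Bezout combination of two quaternions with scalar coefficients `u`, `v` and a
quaternionic coefficient `A` for the mixed terms is a scalar. -/
lemma Quaternion.bezout_combination {R : Type*} [CommRing R] (F₁ F₂ A : Quaternion R) (u v : R) :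
    F₁ * ((u : Quaternion R) * star F₁ + A * star F₂) +
      F₂ * ((v : Quaternion R) * star F₂ + star A * star F₁) =
    ((u * (F₁ * star F₁).re + v * (F₂ * star F₂).re +
      ((star F₂ * F₁ * A).re + (star F₂ * F₁ * A).re) : R) : Quaternion R) := by
  ext <;> simp <;> ring

lemma stemVal_coe_eq_one {s : stemRing D} {z : ℂ} (hs : (s : ℂ → ℂ) z = 1) (J : Quaternion ℝ) :
    stemVal (s : Quaternion (stemRing D)) J z = 1 := by
  have h1 : stemRe (s : Quaternion (stemRing D)) z = 1 := by
    ext <;> simp [hs] <;> rfl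
  have h2 : stemIm (s : Quaternion (stemRing D)) z = 0 := by
    ext <;> simp [hs] <;> rfl
  rw [stemVal, h1, h2, mul_zero, add_zero]

/-- Quaternionic stem functions without common zeros generate the unit right ideal. -/
theorem exists_stem_bezout (hD : IsOpen D) (hconn : IsConnected D) (hsymm : ∀ z ∈ D, conj z ∈ D)
    (F₁ F₂ : Quaternion (stemRing D))
    (hnz : ∀ z ∈ D, ∀ J ∈ QSphere, stemVal F₁ J z ≠ 0 ∨ stemVal F₂ J z ≠ 0) :
    ∃ H₁ H₂ : Quaternion (stemRing D), ∀ z ∈ D, ∀ J,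
      stemVal (F₁ * H₁ + F₂ * H₂) J z = 1 := by
  set P := star F₂ * F₁ with hP
  obtain ⟨u, hu⟩ := exists_stemRing_bezout hD hconn hsymm
    ![(F₁ * star F₁).re, (F₂ * star F₂).re, P.re + P.re, P.imI + P.imI, P.imJ + P.imJ,
      P.imK + P.imK] (by
      intro z hz
      by_contra! hall
      have h1 : ((F₁ * star F₁).re : ℂ → ℂ) z = 0 := hall 0
      have h2 : ((F₂ * star F₂).re : ℂ → ℂ) z = 0 := hall 1
      have h3 : (P.re : ℂ → ℂ) z = 0 := add_self_eq_zero.1 (hall 2)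
      have h4 : (P.imI : ℂ → ℂ) z = 0 := add_self_eq_zero.1 (hall 3)
      have h5 : (P.imJ : ℂ → ℂ) z = 0 := add_self_eq_zero.1 (hall 4)
      have h6 : (P.imK : ℂ → ℂ) z = 0 := add_self_eq_zero.1 (hall 5)
      obtain ⟨J, hJ, hJ1, hJ2⟩ := exists_mem_QSphere_stemVal_eq_zero h1 h2 (by
          rw [← hP]
          ext <;> simp [h3, h4, h5, h6] <;> rfl)
      exact (hnz z hz J hJ).elim (· hJ1) (· hJ2))
  let A : Quaternion (stemRing D) := ⟨u 2, -u 3, -u 4, -u 5⟩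
  refine ⟨(u 0 : Quaternion (stemRing D)) * star F₁ + A * star F₂,
    (u 1 : Quaternion (stemRing D)) * star F₂ + star A * star F₁, fun z hz J => ?_⟩
  rw [Quaternion.bezout_combination, ← hP]
  refine stemVal_coe_eq_one ?_ J
  rw [← hu z hz, Fin.sum_univ_six]
  have hA : (P * A).re = P.re * u 2 + P.imI * u 3 + P.imJ * u 4 + P.imK * u 5 := by
    rw [Quaternion.re_mul]
    change P.re * u 2 - P.imI * -u 3 - P.imJ * -u 4 - P.imK * -u 5 = _
    ring
  rw [hA]
  change (u 0 : ℂ → ℂ) z * ((F₁ * star F₁).re : ℂ → ℂ) z +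
      (u 1 : ℂ → ℂ) z * ((F₂ * star F₂).re : ℂ → ℂ) z +
      ((P.re : ℂ → ℂ) z * (u 2 : ℂ → ℂ) z + (P.imI : ℂ → ℂ) z * (u 3 : ℂ → ℂ) z +
        (P.imJ : ℂ → ℂ) z * (u 4 : ℂ → ℂ) z + (P.imK : ℂ → ℂ) z * (u 5 : ℂ → ℂ) z +
      ((P.re : ℂ → ℂ) z * (u 2 : ℂ → ℂ) z + (P.imI : ℂ → ℂ) z * (u 3 : ℂ → ℂ) z +
        (P.imJ : ℂ → ℂ) z * (u 4 : ℂ → ℂ) z + (P.imK : ℂ → ℂ) z * (u 5 : ℂ → ℂ) z)) =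
    (u 0 : ℂ → ℂ) z * ((F₁ * star F₁).re : ℂ → ℂ) z +
      (u 1 : ℂ → ℂ) z * ((F₂ * star F₂).re : ℂ → ℂ) z +
      (u 2 : ℂ → ℂ) z * ((P.re : ℂ → ℂ) z + (P.re : ℂ → ℂ) z) +
      (u 3 : ℂ → ℂ) z * ((P.imI : ℂ → ℂ) z + (P.imI : ℂ → ℂ) z) +
      (u 4 : ℂ → ℂ) z * ((P.imJ : ℂ → ℂ) z + (P.imJ : ℂ → ℂ) z) +
      (u 5 : ℂ → ℂ) z * ((P.imK : ℂ → ℂ) z + (P.imK : ℂ → ℂ) z)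
  ring

end Stem

section CauchyRiemann

/-- `φ` is continuously differentiable at `p` and satisfies there the left Cauchy-Riemann equation
with respect to `I`. -/
def CRAt (I : Quaternion ℝ) (φ : ℝ × ℝ → Quaternion ℝ) (p : ℝ × ℝ) : Prop :=
  ContDiffAt ℝ 1 φ p ∧ fderiv ℝ φ p (1, 0) + I * fderiv ℝ φ p (0, 1) = 0

variable {I : Quaternion ℝ} {φ ψ : ℝ × ℝ → Quaternion ℝ} {p : ℝ × ℝ}

lemma CRAt.differentiableAt (h : CRAt I φ p) : DifferentiableAt ℝ φ p :=
  h.1.differentiableAt one_ne_zero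

lemma CRAt.add (h₁ : CRAt I φ p) (h₂ : CRAt I ψ p) : CRAt I (φ + ψ) p := by
  refine ⟨h₁.1.add h₂.1, ?_⟩
  rw [fderiv_add h₁.differentiableAt h₂.differentiableAt, ← add_zero (0 : Quaternion ℝ)]
  nth_rewrite 1 [← h₁.2]
  rw [← h₂.2]
  simp only [add_apply, mul_add]
  abel

lemma CRAt.neg (h : CRAt I φ p) : CRAt I (-φ) p := by
  refine ⟨h.1.neg, ?_⟩
  rw [fderiv_neg, neg_apply, neg_apply, mul_neg, ← neg_add, h.2, neg_zero]

lemma CRAt.congr (h : CRAt I φ p) (he : ψ =ᶠ[𝓝 p] φ) : CRAt I ψ p :=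
  ⟨h.1.congr_of_eventuallyEq he, by rw [he.fderiv_eq]; exact h.2⟩

/-- The real-linear map from `ℂ` onto the slice `L_I`, multiplied by a constant on the right. -/
def sliceEmb (I c : Quaternion ℝ) : ℂ →L[ℝ] Quaternion ℝ :=
  Complex.reCLM.smulRight c + Complex.imCLM.smulRight (I * c)

lemma sliceEmb_apply (I c : Quaternion ℝ) (w : ℂ) :
    sliceEmb I c w = w.re • c + w.im • (I * c) := rfl

lemma sliceEmb_I_mul (hI : I ∈ QSphere) (c : Quaternion ℝ) (w : ℂ) :
    sliceEmb I c (Complex.I * w) = I * sliceEmb I c w := by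
  have h : I * (I * c) = -c := by rw [← mul_assoc, QSphere.mul_self hI, neg_one_mul]
  simp only [sliceEmb_apply, mul_add, mul_smul_comm, h]
  simp
  abel

lemma CRAt_sliceEmb (hI : I ∈ QSphere) (c : Quaternion ℝ) {g : ℂ → ℂ}
    (hg : AnalyticAt ℂ g ⟨p.1, p.2⟩) : CRAt I (fun r => sliceEmb I c (g ⟨r.1, r.2⟩)) p := by
  have hg1 : ContDiffAt ℝ 1 g (Complex.equivRealProdCLM.symm p) := hg.contDiffAt.restrict_scalars ℝ
  refine ⟨(sliceEmb I c).contDiff.contDiffAt.comp p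
    (hg1.comp p Complex.equivRealProdCLM.symm.contDiff.contDiffAt), ?_⟩
  have hd : HasFDerivAt g
      ((ContinuousLinearMap.toSpanSingleton ℂ (deriv g ⟨p.1, p.2⟩)).restrictScalars ℝ)
      (Complex.equivRealProdCLM.symm p) :=
    hg.differentiableAt.hasDerivAt.hasFDerivAt.restrictScalars ℝ
  have h := (sliceEmb I c).hasFDerivAt.comp p
    (hd.comp p (Complex.equivRealProdCLM.symm : (ℝ × ℝ) ≃L[ℝ] ℂ).hasFDerivAt)
  have h' : HasFDerivAt (fun r : ℝ × ℝ => sliceEmb I c (g ⟨r.1, r.2⟩)) _ p := h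
  rw [h'.fderiv]
  have e1 : Complex.equivRealProdCLM.symm (1, 0) = 1 := by
    apply Complex.ext <;> simp
  have e2 : Complex.equivRealProdCLM.symm (0, 1) = Complex.I := by
    apply Complex.ext <;> simp
  simp only [ContinuousLinearMap.comp_apply, ContinuousLinearEquiv.coe_coe, e1, e2,
    ContinuousLinearMap.coe_restrictScalars', ContinuousLinearMap.toSpanSingleton_apply,
    smul_eq_mul, one_mul, sliceEmb_I_mul hI]
  rw [← mul_assoc, QSphere.mul_self hI, neg_one_mul, add_neg_cancel]

/-- The `L_J`-linear extension of a real functional. -/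
def sliceDual (J : Quaternion ℝ) (l : Quaternion ℝ →L[ℝ] ℝ) : Quaternion ℝ →L[ℝ] ℂ :=
  Complex.ofRealCLM.comp l -
    Complex.I • Complex.ofRealCLM.comp (l.comp (ContinuousLinearMap.mul ℝ (Quaternion ℝ) J))

lemma sliceDual_apply (J : Quaternion ℝ) (l : Quaternion ℝ →L[ℝ] ℝ) (q : Quaternion ℝ) :
    sliceDual J l q = l q - Complex.I * l (J * q) := rfl

lemma sliceDual_mul (hI : I ∈ QSphere) (l : Quaternion ℝ →L[ℝ] ℝ) (q : Quaternion ℝ) :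
    sliceDual I l (I * q) = Complex.I * sliceDual I l q := by
  have h : I * (I * q) = -q := by rw [← mul_assoc, QSphere.mul_self hI, neg_one_mul]
  rw [sliceDual_apply, sliceDual_apply, h, mul_sub, ← mul_assoc, Complex.I_mul_I, map_neg,
    Complex.ofReal_neg]
  ring

lemma CRAt.differentiableAt_sliceDual (hI : I ∈ QSphere) (l : Quaternion ℝ →L[ℝ] ℝ) {z : ℂ}
    (h : CRAt I φ (z.re, z.im)) :
    DifferentiableAt ℂ (fun w : ℂ => sliceDual I l (φ (w.re, w.im))) z := by
  have hd : HasFDerivAt φ (fderiv ℝ φ (z.re, z.im)) (Complex.equivRealProdCLM z) :=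
    h.differentiableAt.hasFDerivAt
  have h1 := (sliceDual I l).hasFDerivAt.comp z (hd.comp z
    (Complex.equivRealProdCLM : ℂ ≃L[ℝ] ℝ × ℝ).hasFDerivAt)
  have h2 : HasFDerivAt (fun w : ℂ => sliceDual I l (φ (w.re, w.im))) _ z := h1
  rw [differentiableAt_complex_iff_differentiableAt_real]
  refine ⟨h2.differentiableAt, ?_⟩
  rw [h2.fderiv]
  have e1 : Complex.equivRealProdCLM 1 = (1, 0) := by simp
  have e2 : Complex.equivRealProdCLM Complex.I = (0, 1) := by simp
  have e3 : fderiv ℝ φ (z.re, z.im) (0, 1) = I * fderiv ℝ φ (z.re, z.im) (1, 0) := by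
    rw [eq_neg_of_add_eq_zero_left h.2, mul_neg, ← mul_assoc, QSphere.mul_self hI, neg_one_mul,
      neg_neg]
  simp only [ContinuousLinearMap.comp_apply, ContinuousLinearEquiv.coe_coe, e1, e2, e3,
    sliceDual_mul hI, smul_eq_mul]

/-- The identity principle: a function satisfying the Cauchy-Riemann equation vanishes if it
vanishes at the real points. -/
lemma eq_zero_of_CRAt_of_real {D : Set ℂ} (hD : IsOpen D) (hconn : IsConnected D) {x₀ : ℝ}
    (hx₀ : (x₀ : ℂ) ∈ D) (hI : I ∈ QSphere) (hφ : ∀ z ∈ D, CRAt I φ (z.re, z.im))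
    (hreal : ∀ x : ℝ, (x : ℂ) ∈ D → φ (x, 0) = 0) {z : ℂ} (hz : z ∈ D) : φ (z.re, z.im) = 0 := by
  refine SeparatingDual.eq_zero_of_forall_dual_eq_zero (R := ℝ) fun l => ?_
  have hdiff : DifferentiableOn ℂ (fun w : ℂ => sliceDual I l (φ (w.re, w.im))) D := fun w hw =>
    ((hφ w hw).differentiableAt_sliceDual hI l).differentiableWithinAt
  have hfreq : ∃ᶠ w in 𝓝[≠] (x₀ : ℂ), sliceDual I l (φ (w.re, w.im)) = 0 := by
    have ht : Tendsto (fun x : ℝ => (x : ℂ)) (𝓝[≠] x₀) (𝓝[≠] (x₀ : ℂ)) :=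
      tendsto_nhdsWithin_of_tendsto_nhds_of_eventually_within _
        (Complex.continuous_ofReal.continuousAt.tendsto.mono_left nhdsWithin_le_nhds)
        (eventually_mem_nhdsWithin.mono fun x hx => by simpa using hx)
    refine ht.frequently (Eventually.frequently ?_)
    have hnear : ∀ᶠ x : ℝ in 𝓝[≠] x₀, (x : ℂ) ∈ D :=
      (Complex.continuous_ofReal.continuousAt.tendsto.mono_left nhdsWithin_le_nhds).eventually
        (hD.mem_nhds hx₀)
    filter_upwards [hnear] with x hx
    rw [Complex.ofReal_re, Complex.ofReal_im, hreal x hx, map_zero]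
  have h := (hdiff.analyticOnNhd hD).eqOn_zero_of_preconnected_of_frequently_eq_zero
    hconn.isPreconnected hx₀ hfreq hz
  have h' := congrArg Complex.re h
  simpa [sliceDual_apply] using h'

end CauchyRiemann

section StemRegular

variable {D : Set ℂ}

/-- The imaginary unit `j`. -/
def unitJ : Quaternion ℝ := ⟨0, 0, 1, 0⟩

@[simp] lemma re_unitJ : unitJ.re = 0 := rfl

@[simp] lemma imI_unitJ : unitJ.imI = 0 := rfl

@[simp] lemma imJ_unitJ : unitJ.imJ = 1 := rfl

@[simp] lemma imK_unitJ : unitJ.imK = 0 := rfl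

/-- The imaginary unit `k`. -/
def unitK : Quaternion ℝ := ⟨0, 0, 0, 1⟩

@[simp] lemma re_unitK : unitK.re = 0 := rfl

@[simp] lemma imI_unitK : unitK.imI = 0 := rfl

@[simp] lemma imJ_unitK : unitK.imJ = 0 := rfl

@[simp] lemma imK_unitK : unitK.imK = 1 := rfl

/-- The decomposition of a quaternion along the standard basis. -/
lemma Quaternion.eq_sum_smul_basis (q : Quaternion ℝ) :
    q = q.re • 1 + q.imI • unitI + q.imJ • unitJ + q.imK • unitK := by
  ext <;> simp [Quaternion.re_one, Quaternion.imI_one, Quaternion.imJ_one, Quaternion.imK_one]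

lemma CRAt_stemVal (hD : IsOpen D) {I : Quaternion ℝ} (hI : I ∈ QSphere)
    (F : Quaternion (stemRing D)) {z : ℂ} (hz : z ∈ D) :
    CRAt I (fun r => stemVal F I ⟨r.1, r.2⟩) (z.re, z.im) := by
  have han (g : stemRing D) (c : Quaternion ℝ) :
      CRAt I (fun r => sliceEmb I c ((g : ℂ → ℂ) ⟨r.1, r.2⟩)) (z.re, z.im) :=
    CRAt_sliceEmb hI c (g.2.1.analyticAt (hD.mem_nhds hz))
  refine ((((han F.re 1).add (han F.imI unitI)).add (han F.imJ unitJ)).add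
    (han F.imK unitK)).congr (Eventually.of_forall fun r => ?_)
  have e (a b : Quaternion ℝ) : a + I * b = (a.re • 1 + b.re • (I * 1)) +
      (a.imI • unitI + b.imI • (I * unitI)) + (a.imJ • unitJ + b.imJ • (I * unitJ)) +
      (a.imK • unitK + b.imK • (I * unitK)) := by
    nth_rewrite 1 [Quaternion.eq_sum_smul_basis a, Quaternion.eq_sum_smul_basis b]
    simp only [mul_add, mul_smul_comm]
    abel
  exact e _ _

end StemRegular

section Slice

/-- The planar set `{x + iy : x + yI ∈ Ω}` of an axially symmetric set `Ω`. -/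
def planarTrace (Ω : Set (Quaternion ℝ)) : Set ℂ :=
  {z | (z.re : Quaternion ℝ) + (z.im : Quaternion ℝ) * unitI ∈ Ω}

variable {Ω : Set (Quaternion ℝ)}

lemma IsSymmSliceDomain.mem_planarTrace_iff (hΩ : IsSymmSliceDomain Ω) {J : Quaternion ℝ}
    (hJ : J ∈ QSphere) {z : ℂ} :
    z ∈ planarTrace Ω ↔ (z.re : Quaternion ℝ) + (z.im : Quaternion ℝ) * J ∈ Ω :=
  ⟨fun h => hΩ.2.2.2.2 _ _ _ unitI_mem_QSphere h _ hJ,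
    fun h => hΩ.2.2.2.2 _ _ _ hJ h _ unitI_mem_QSphere⟩

lemma IsSymmSliceDomain.isOpen_planarTrace (hΩ : IsSymmSliceDomain Ω) :
    IsOpen (planarTrace Ω) := by
  refine hΩ.1.preimage (f := fun z : ℂ => (z.re : Quaternion ℝ) + (z.im : Quaternion ℝ) * unitI) ?_
  have h1 : Continuous fun z : ℂ => (z.re : Quaternion ℝ) :=
    Quaternion.continuous_coe.comp Complex.continuous_re
  have h2 : Continuous fun z : ℂ => (z.im : Quaternion ℝ) :=
    Quaternion.continuous_coe.comp Complex.continuous_im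
  exact h1.add (h2.mul continuous_const)

lemma IsSymmSliceDomain.isConnected_planarTrace (hΩ : IsSymmSliceDomain Ω) :
    IsConnected (planarTrace Ω) := by
  have h := (hΩ.2.2.2.1 unitI unitI_mem_QSphere).image
    (fun q => Complex.equivRealProdCLM.symm (q.re, q.imI))
    (Complex.equivRealProdCLM.symm.continuous.comp
      (Quaternion.continuous_re.prodMk Quaternion.continuous_imI)).continuousOn
  convert h using 1
  ext z
  constructor
  · intro hz
    refine ⟨_, ⟨hz, z.re, z.im, rfl⟩, ?_⟩
    apply Complex.ext <;> simp
  · rintro ⟨_, ⟨hq, x, y, rfl⟩, rfl⟩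
    simpa [planarTrace] using hq

lemma IsSymmSliceDomain.conj_mem_planarTrace (hΩ : IsSymmSliceDomain Ω) {z : ℂ}
    (hz : z ∈ planarTrace Ω) : conj z ∈ planarTrace Ω := by
  rw [hΩ.mem_planarTrace_iff (QSphere.neg_mem unitI_mem_QSphere)]
  simpa [planarTrace] using hz

/-- Every quaternion lies on a slice. -/
lemma Quaternion.exists_eq_add_mul_of_mem_QSphere (q : Quaternion ℝ) :
    ∃ z : ℂ, ∃ I ∈ QSphere, q = (z.re : Quaternion ℝ) + (z.im : Quaternion ℝ) * I := by
  obtain ⟨J, hJ, h⟩ := exists_mem_QSphere_add_mul_eq_zero (a := q.im) (b := (‖q.im‖ : ℝ))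
    (by rw [Quaternion.normSq_coe, Quaternion.normSq_eq_norm_mul_self, sq]) (by simp)
  refine ⟨⟨q.re, -‖q.im‖⟩, J, hJ, ?_⟩
  rw [← Quaternion.coe_commutes] at h
  rw [Quaternion.coe_neg, neg_mul, ← eq_neg_of_add_eq_zero_left h, Quaternion.re_add_im]

lemma SliceRegularOn.CRAt_sliceMap (hΩ : IsSymmSliceDomain Ω) {f : Quaternion ℝ → Quaternion ℝ}
    (hf : SliceRegularOn f Ω) {J : Quaternion ℝ} (hJ : J ∈ QSphere) {z : ℂ}
    (hz : z ∈ planarTrace Ω) : CRAt J (sliceMap f J) (z.re, z.im) :=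
  hf J hJ z.re z.im ((hΩ.mem_planarTrace_iff hJ).1 hz)

/-- A real component of a slice regular function extends from the real points to a function in
the stem ring. -/
lemma SliceRegularOn.exists_stemRing_extension (hΩ : IsSymmSliceDomain Ω)
    {f : Quaternion ℝ → Quaternion ℝ} (hf : SliceRegularOn f Ω) (l : Quaternion ℝ →L[ℝ] ℝ) :
    ∃ g : stemRing (planarTrace Ω), ∀ x : ℝ, (g : ℂ → ℂ) x = l (f x) := by
  refine ⟨⟨conjSymm fun w => sliceDual unitI l (sliceMap f unitI (w.re, w.im)),
    conjSymm_mem_stemRing hΩ.isOpen_planarTrace (fun z hz => hΩ.conj_mem_planarTrace hz)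
      fun w hw => ((hf.CRAt_sliceMap hΩ unitI_mem_QSphere hw).differentiableAt_sliceDual
        unitI_mem_QSphere l).differentiableWithinAt⟩, fun x => ?_⟩
  simp [conjSymm, sliceDual_apply, sliceMap]

/-- Every slice regular function on a symmetric slice domain is induced by a stem function. -/
lemma SliceRegularOn.exists_stem (hΩ : IsSymmSliceDomain Ω) {f : Quaternion ℝ → Quaternion ℝ}
    (hf : SliceRegularOn f Ω) :
    ∃ F : Quaternion (stemRing (planarTrace Ω)), ∀ z ∈ planarTrace Ω, ∀ J ∈ QSphere,
      f ((z.re : Quaternion ℝ) + (z.im : Quaternion ℝ) * J) = stemVal F J z := by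
  have hD := hΩ.isOpen_planarTrace
  obtain ⟨g₀, h₀⟩ := hf.exists_stemRing_extension hΩ
    ⟨QuaternionAlgebra.reₗ (-1) 0 (-1), Quaternion.continuous_re⟩
  obtain ⟨g₁, h₁⟩ := hf.exists_stemRing_extension hΩ
    ⟨QuaternionAlgebra.imIₗ (-1) 0 (-1), Quaternion.continuous_imI⟩
  obtain ⟨g₂, h₂⟩ := hf.exists_stemRing_extension hΩ
    ⟨QuaternionAlgebra.imJₗ (-1) 0 (-1), Quaternion.continuous_imJ⟩
  obtain ⟨g₃, h₃⟩ := hf.exists_stemRing_extension hΩ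
    ⟨QuaternionAlgebra.imKₗ (-1) 0 (-1), Quaternion.continuous_imK⟩
  let F : Quaternion (stemRing (planarTrace Ω)) := ⟨g₀, g₁, g₂, g₃⟩
  refine ⟨F, fun z hz J hJ => ?_⟩
  have hre (x : ℝ) : stemRe F x = f x := by
    ext
    · exact congrArg Complex.re (h₀ x)
    · exact congrArg Complex.re (h₁ x)
    · exact congrArg Complex.re (h₂ x)
    · exact congrArg Complex.re (h₃ x)
  have him (x : ℝ) : stemIm F x = 0 := by
    ext
    · exact congrArg Complex.im (h₀ x)
    · exact congrArg Complex.im (h₁ x)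
    · exact congrArg Complex.im (h₂ x)
    · exact congrArg Complex.im (h₃ x)
  obtain ⟨x₀, hx₀⟩ := hΩ.2.2.1
  have h := eq_zero_of_CRAt_of_real hD hΩ.isConnected_planarTrace (x₀ := x₀)
    (by simpa [planarTrace] using hx₀) hJ
    (φ := sliceMap f J + -fun r => stemVal F J ⟨r.1, r.2⟩)
    (fun w hw => (hf.CRAt_sliceMap hΩ hJ hw).add (CRAt_stemVal hD hJ F hw).neg)
    (fun x _ => ?_) hz
  · exact add_neg_eq_zero.1 h
  · have hval : stemVal F J x = f x := by rw [stemVal, hre, him, mul_zero, add_zero]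
    change f ((x : Quaternion ℝ) + ((0 : ℝ) : Quaternion ℝ) * J) + -stemVal F J x = 0
    rw [hval, Quaternion.coe_zero, zero_mul, add_zero, add_neg_cancel]

/-- Every stem function induces a slice regular function. -/
lemma exists_sliceRegularOn_of_stem (hΩ : IsSymmSliceDomain Ω)
    (H : Quaternion (stemRing (planarTrace Ω))) :
    ∃ h : Quaternion ℝ → Quaternion ℝ, SliceRegularOn h Ω ∧ ∀ z ∈ planarTrace Ω, ∀ J ∈ QSphere,
      h ((z.re : Quaternion ℝ) + (z.im : Quaternion ℝ) * J) = stemVal H J z := by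
  have hD := hΩ.isOpen_planarTrace
  let h (q : Quaternion ℝ) : Quaternion ℝ := stemVal H (‖q.im‖⁻¹ • q.im) ⟨q.re, ‖q.im‖⟩
  have hval : ∀ z ∈ planarTrace Ω, ∀ J ∈ QSphere,
      h ((z.re : Quaternion ℝ) + (z.im : Quaternion ℝ) * J) = stemVal H J z := by
    intro z hz J hJ
    have hre : ((z.re : Quaternion ℝ) + (z.im : Quaternion ℝ) * J).re = z.re := by
      simp [QSphere.re_eq_zero hJ]
    have him : ((z.re : Quaternion ℝ) + (z.im : Quaternion ℝ) * J).im = z.im • J := by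
      have := QSphere.re_eq_zero hJ
      ext <;> simp [this]
    have hn : ‖z.im • J‖ = |z.im| := by
      rw [norm_smul, QSphere.norm_eq_one hJ, mul_one, Real.norm_eq_abs]
    simp only [h, hre, him, hn, smul_smul]
    rcases lt_trichotomy z.im 0 with hlt | heq | hgt
    · rw [abs_of_neg hlt, inv_neg, neg_mul, inv_mul_cancel₀ hlt.ne, neg_one_smul,
        ← stemVal_conj H J hz]
      rfl
    · have hc : conj z = z := Complex.conj_eq_iff_im.2 heq
      have h0 : stemIm H z = 0 := by
        have := stemIm_conj H hz
        rw [hc] at this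
        rw [eq_neg_iff_add_eq_zero, ← two_smul ℝ] at this
        exact (smul_eq_zero.1 this).resolve_left two_ne_zero
      have hz' : (⟨z.re, |z.im|⟩ : ℂ) = z := by
        apply Complex.ext <;> simp [heq]
      rw [hz', stemVal, stemVal, h0, mul_zero, mul_zero]
    · rw [abs_of_pos hgt, inv_mul_cancel₀ hgt.ne', one_smul]
  refine ⟨h, fun I hI x y hxy => ?_, hval⟩
  have hz : (⟨x, y⟩ : ℂ) ∈ planarTrace Ω := (hΩ.mem_planarTrace_iff hI).2 hxy
  refine (CRAt_stemVal hD hI H hz).congr ?_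
  have hc : Tendsto (fun p : ℝ × ℝ => Complex.equivRealProdCLM.symm p) (𝓝 (x, y))
      (𝓝 (⟨x, y⟩ : ℂ)) := Complex.equivRealProdCLM.symm.continuous.continuousAt
  filter_upwards [hc.eventually (hD.mem_nhds hz)] with p hp
  exact hval _ hp I hI

/-- The pointwise regular product of induced functions is induced by the product of the stem
functions. -/
lemma starMulVal_eq_stemVal_mul {D : Set ℂ} {f h : Quaternion ℝ → Quaternion ℝ}
    {F H : Quaternion (stemRing D)} {z : ℂ} {I : Quaternion ℝ} (hI : I ∈ QSphere)
    (hf : f ((z.re : Quaternion ℝ) + (z.im : Quaternion ℝ) * I) = stemVal F I z)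
    (hh : ∀ J ∈ QSphere, h ((z.re : Quaternion ℝ) + (z.im : Quaternion ℝ) * J) = stemVal H J z) :
    starMulVal f h ((z.re : Quaternion ℝ) + (z.im : Quaternion ℝ) * I) =
      stemVal (F * H) I z := by
  rw [starMulVal, hf, stemVal_mul hI]
  split_ifs with hc
  · rw [hc, mul_zero, zero_mul, zero_mul, add_zero]
  · set c := stemVal F I z
    have hq : c⁻¹ * ((z.re : Quaternion ℝ) + (z.im : Quaternion ℝ) * I) * c =
        (z.re : Quaternion ℝ) + (z.im : Quaternion ℝ) * (c⁻¹ * I * c) := by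
      rw [mul_add, add_mul, ← Quaternion.coe_commutes, mul_assoc, inv_mul_cancel₀ hc, mul_one,
        ← mul_assoc c⁻¹, ← Quaternion.coe_commutes]
      simp only [mul_assoc]
    rw [hq, hh _ (QSphere.inv_mul_mul_mem hI hc), stemVal, mul_add]
    simp only [← mul_assoc, mul_inv_cancel₀ hc, one_mul]

end Slice

end Auxiliary

/-- If two slice regular functions on a symmetric slice domain `Ω` have no common
zeros, then there are slice regular `h₁, h₂` with `f₁ * h₁ + f₂ * h₂ = 1`
pointwise on `Ω`. -/
theorem ideal_generated_by_two_regular_functions_without_common_zeros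
    (Ω : Set (Quaternion ℝ)) (hΩ : IsSymmSliceDomain Ω)
    (f₁ f₂ : Quaternion ℝ → Quaternion ℝ)
    (hreg₁ : SliceRegularOn f₁ Ω) (hreg₂ : SliceRegularOn f₂ Ω)
    (hnz : ∀ q ∈ Ω, f₁ q ≠ 0 ∨ f₂ q ≠ 0) :
    ∃ h₁ h₂ : Quaternion ℝ → Quaternion ℝ,
      SliceRegularOn h₁ Ω ∧ SliceRegularOn h₂ Ω ∧
      ∀ q ∈ Ω, starMulVal f₁ h₁ q + starMulVal f₂ h₂ q = 1 := by
  obtain ⟨F₁, hF₁⟩ := hreg₁.exists_stem hΩ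
  obtain ⟨F₂, hF₂⟩ := hreg₂.exists_stem hΩ
  obtain ⟨H₁, H₂, hH⟩ := exists_stem_bezout hΩ.isOpen_planarTrace hΩ.isConnected_planarTrace
    (fun z hz => hΩ.conj_mem_planarTrace hz) F₁ F₂ (fun z hz J hJ => by
      rw [← hF₁ z hz J hJ, ← hF₂ z hz J hJ]
      exact hnz _ ((hΩ.mem_planarTrace_iff hJ).1 hz))
  obtain ⟨h₁, hr₁, hh₁⟩ := exists_sliceRegularOn_of_stem hΩ H₁
  obtain ⟨h₂, hr₂, hh₂⟩ := exists_sliceRegularOn_of_stem hΩ H₂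
  refine ⟨h₁, h₂, hr₁, hr₂, fun q hq => ?_⟩
  obtain ⟨z, I, hI, rfl⟩ := q.exists_eq_add_mul_of_mem_QSphere
  have hz := (hΩ.mem_planarTrace_iff hI).2 hq
  rw [starMulVal_eq_stemVal_mul hI (hF₁ z hz I hI) (hh₁ z hz),
    starMulVal_eq_stemVal_mul hI (hF₂ z hz I hI) (hh₂ z hz), ← stemVal_add, hH z hz]
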